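/- Let n, m ≥ 1 and for j = 1,…,m let Ω_j : ℝⁿ → ℝ satisfy: Ω_j(λy) = Ω_j(y) for all λ > 0 and y ∈ ℝⁿ; |Ω_j(ξ) − Ω_j(η)| ≤ C₀|ξ/|ξ| − η/|η||^β for some 0 < β < 1 and C₀ > 0; and ∫_{S^{n−1}} Ω_j dσ = 0. Let 0 < α_j < 1/m for j = 1,…,m, and suppose α = α₁+⋯+α_m satisfies 0 < α < β/2. Then for f_j ∈ Lip_{α_j}(ℝⁿ), the separated multilinear Marcinkiewicz integral μ̃(f⃗) is either infinite everywhere on ℝⁿ or finite almost everywhere, and in the latter case ‖μ̃(f⃗)‖_{Lip_α} ≤ C ∏_{j=1}^m ‖f_j‖_{Lip_{α_j}} with C independent of f⃗. -/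

import Mathlib

open MeasureTheory Metric ENNReal

noncomputable def ballAvg (n : ℕ) (f : EuclideanSpace ℝ (Fin n) → ℝ)
    (c : EuclideanSpace ℝ (Fin n)) (r : ℝ) : ℝ :=
  (volume (closedBall c r)).toReal⁻¹ * ∫ y in closedBall c r, f y

noncomputable def bmoNorm (n : ℕ) (f : EuclideanSpace ℝ (Fin n) → ℝ) : ℝ≥0∞ :=
  ⨆ (c : EuclideanSpace ℝ (Fin n)) (r : ℝ) (_ : 0 < r),
    ENNReal.ofReal ((volume (closedBall c r)).toReal⁻¹ *
      ∫ y in closedBall c r, |f y - ballAvg n f c r|)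

noncomputable def campanatoNorm (n : ℕ) (α p : ℝ) (f : EuclideanSpace ℝ (Fin n) → ℝ) : ℝ≥0∞ :=
  ⨆ (c : EuclideanSpace ℝ (Fin n)) (r : ℝ) (_ : 0 < r),
    ENNReal.ofReal ((volume (closedBall c r)).toReal ^ (-(α / n)) *
      ((volume (closedBall c r)).toReal⁻¹ *
        ∫ y in closedBall c r, |f y - ballAvg n f c r| ^ p) ^ (1 / p))

noncomputable def campanato1Norm (n : ℕ) (α : ℝ) (f : EuclideanSpace ℝ (Fin n) → ℝ) : ℝ≥0∞ :=
  ⨆ (c : EuclideanSpace ℝ (Fin n)) (r : ℝ) (_ : 0 < r),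
    ENNReal.ofReal ((volume (closedBall c r)).toReal ^ (-(α / n)) *
      ((volume (closedBall c r)).toReal⁻¹ *
        ∫ y in closedBall c r, |f y - ballAvg n f c r|))

noncomputable def lipNorm (n : ℕ) (γ : ℝ) (f : EuclideanSpace ℝ (Fin n) → ℝ) : ℝ≥0∞ :=
  ⨆ (x : EuclideanSpace ℝ (Fin n)) (y : EuclideanSpace ℝ (Fin n)) (_ : x ≠ y),
    ENNReal.ofReal (|f x - f y| / ‖x - y‖ ^ γ)

noncomputable def sFt (n m : ℕ) (Ω : Fin m → EuclideanSpace ℝ (Fin n) → ℝ)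
    (f : Fin m → EuclideanSpace ℝ (Fin n) → ℝ) (t : ℝ) (x : EuclideanSpace ℝ (Fin n)) : ℝ :=
  t ^ (-(m : ℝ)) * ∏ j, ∫ y in closedBall (0 : EuclideanSpace ℝ (Fin n)) t,
    Ω j y / ‖y‖ ^ ((n : ℝ) - 1) * f j (x - y)

noncomputable def smarc (n m : ℕ) (Ω : Fin m → EuclideanSpace ℝ (Fin n) → ℝ)
    (f : Fin m → EuclideanSpace ℝ (Fin n) → ℝ) (x : EuclideanSpace ℝ (Fin n)) : ℝ≥0∞ :=
  (∫⁻ t in Set.Ioi (0 : ℝ), ENNReal.ofReal ((sFt n m Ω f t x) ^ 2 / t)) ^ (1 / 2 : ℝ)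


namespace MI


lemma unit_diff {n : ℕ} (u v : EuclideanSpace ℝ (Fin n)) (hu : u ≠ 0) (hv : v ≠ 0) :
    ‖‖u‖⁻¹ • u - ‖v‖⁻¹ • v‖ ≤ 2 * ‖u - v‖ / ‖v‖ := by
  have hu' : 0 < ‖u‖ := norm_pos_iff.mpr hu
  have hv' : 0 < ‖v‖ := norm_pos_iff.mpr hv
  have e : ‖u‖⁻¹ • u - ‖v‖⁻¹ • v = ‖v‖⁻¹ • (u - v) + (‖u‖⁻¹ - ‖v‖⁻¹) • u := by
    module
  rw [e]
  refine (norm_add_le _ _).trans ?_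
  rw [norm_smul, norm_smul, Real.norm_eq_abs, Real.norm_eq_abs, abs_of_pos (inv_pos.mpr hv')]
  have h2 : |‖u‖⁻¹ - ‖v‖⁻¹| * ‖u‖ = |‖v‖ - ‖u‖| / ‖v‖ := by
    have : ‖u‖⁻¹ - ‖v‖⁻¹ = (‖v‖ - ‖u‖) / (‖u‖ * ‖v‖) := by field_simp
    rw [this, abs_div, abs_of_pos (mul_pos hu' hv')]
    field_simp
  rw [h2]
  have h3 : |‖v‖ - ‖u‖| ≤ ‖u - v‖ := by
    rw [abs_sub_comm]; exact abs_norm_sub_norm_le u v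
  have : |‖v‖ - ‖u‖| / ‖v‖ ≤ ‖u - v‖ / ‖v‖ := by gcongr
  calc _ ≤ ‖v‖⁻¹ * ‖u - v‖ + ‖u - v‖ / ‖v‖ := by gcongr
    _ = _ := by ring

/-- radial profile -/
noncomputable def W (N : ℕ) (s : ℝ) : ℝ := if s ≤ 1 then (s ^ N)⁻¹ else 0

lemma W_nonneg (N : ℕ) {s : ℝ} (hs : 0 ≤ s) : 0 ≤ W N s := by
  unfold W; split_ifs <;> positivity

lemma radial (N : ℕ) {β a b d : ℝ} (hβ0 : 0 < β) (hβ1 : β < 1) (ha : 0 < a) (ha1 : a < 1)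
    (hb : 0 < b) (hd : 0 ≤ d) (hbd : b ≤ a + d) :
    W N a - W N b ≤ d ^ β * ((N * a ^ (-β) + (1 - a) ^ (-β)) * (a ^ N)⁻¹) := by
  have h1a : 0 < 1 - a := by linarith
  have hWa : W N a = (a ^ N)⁻¹ := by simp [W, ha1.le]
  have haN : 0 < (a ^ N)⁻¹ := by positivity
  have hda : d ^ β * a ^ (-β) = (d / a) ^ β := by
    rw [Real.div_rpow hd ha.le, Real.rpow_neg ha.le]; rfl
  have hd1 : d ^ β * (1 - a) ^ (-β) = (d / (1 - a)) ^ β := by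
    rw [Real.div_rpow hd h1a.le, Real.rpow_neg h1a.le]; rfl
  have key : d ^ β * ((N * a ^ (-β) + (1 - a) ^ (-β)) * (a ^ N)⁻¹)
      = (a ^ N)⁻¹ * (N * (d / a) ^ β + (d / (1 - a)) ^ β) := by
    rw [← hda, ← hd1]; ring
  rw [key]
  have p1 : 0 ≤ (d / a) ^ β := by positivity
  have p2 : 0 ≤ (d / (1 - a)) ^ β := Real.rpow_nonneg (div_nonneg hd h1a.le) _
  by_cases hb1 : b ≤ 1
  · have hWb : W N b = (b ^ N)⁻¹ := by simp [W, hb1]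
    have hge : ((a + d) ^ N)⁻¹ ≤ W N b := by
      rw [hWb]; gcongr
    have hx : (a ^ N)⁻¹ - ((a + d) ^ N)⁻¹ = (a ^ N)⁻¹ * (1 - (a / (a + d)) ^ N) := by
      rw [div_pow]; field_simp
    have hbern : 1 + (N : ℝ) * (-(d / (a + d))) ≤ (1 + -(d / (a + d))) ^ N := by
      apply one_add_mul_le_pow
      have : d / (a + d) ≤ 1 := by rw [div_le_one (by linarith)]; linarith
      linarith
    have he : 1 + -(d / (a + d)) = a / (a + d) := by field_simp; ring
    rw [he] at hbern
    have hq : d / (a + d) ≤ (d / a) ^ β := by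
      calc d / (a + d) ≤ (d / (a + d)) ^ β :=
            Real.self_le_rpow_of_le_one (by positivity)
              (by rw [div_le_one (by linarith)]; linarith) hβ1.le
        _ ≤ _ := by
            apply Real.rpow_le_rpow (by positivity) _ hβ0.le
            gcongr; linarith
    calc W N a - W N b ≤ (a ^ N)⁻¹ - ((a + d) ^ N)⁻¹ := by rw [hWa]; linarith
      _ = (a ^ N)⁻¹ * (1 - (a / (a + d)) ^ N) := hx
      _ ≤ _ := by
        apply mul_le_mul_of_nonneg_left _ haN.le
        have : (N : ℝ) * (d / (a + d)) ≤ N * (d / a) ^ β := by gcongr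
        linarith
  · have hWb : W N b = 0 := by simp [W, hb1]
    rw [hWb, hWa]
    have : 1 ≤ (d / (1 - a)) ^ β := by
      apply Real.one_le_rpow _ hβ0.le
      rw [le_div_iff₀ h1a]; linarith
    have h2 : 1 ≤ (N * (d / a) ^ β + (d / (1 - a)) ^ β) := by
      have : 0 ≤ (N:ℝ) * (d / a) ^ β := by positivity
      linarith
    nlinarith

/-- majorant profile -/
noncomputable def g0 (N : ℕ) (β A : ℝ) (s : ℝ) : ℝ :=
  if s < 1 then A * ((s ^ (-β) + (1 - s) ^ (-β)) * (s ^ N)⁻¹) else 0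

lemma g0_nonneg (N : ℕ) {β A s : ℝ} (hA : 0 ≤ A) (hs : 0 ≤ s) : 0 ≤ g0 N β A s := by
  unfold g0; split_ifs with h
  · have : 0 ≤ 1 - s := by linarith
    positivity
  · rfl

lemma g0_integrable {n : ℕ} (hn : 1 ≤ n) {β A : ℝ} (hβ0 : 0 < β) (hβ1 : β < 1) :
    Integrable (fun x : EuclideanSpace ℝ (Fin n) => g0 (n - 1) β A ‖x‖) := by
  have : Nonempty (Fin n) := ⟨⟨0, hn⟩⟩
  rw [integrable_fun_norm_addHaar volume (f := g0 (n - 1) β A), finrank_euclideanSpace_fin]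
  have h1 : IntegrableOn (fun s : ℝ => s ^ (-β)) (Set.Ioc 0 1) := by
    have := intervalIntegral.intervalIntegrable_rpow' (a := 0) (b := 1) (r := -β) (by linarith)
    rwa [intervalIntegrable_iff_integrableOn_Ioc_of_le zero_le_one] at this
  have h2 : IntegrableOn (fun s : ℝ => (1 - s) ^ (-β)) (Set.Ioc 0 1) := by
    have := (intervalIntegral.intervalIntegrable_rpow' (a := 0) (b := 1) (r := -β)
      (by linarith)).comp_sub_left 1
    simp only [sub_zero, sub_self] at this
    have := this.symm
    rwa [intervalIntegrable_iff_integrableOn_Ioc_of_le zero_le_one] at this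
  have h3 : IntegrableOn (fun s : ℝ => A * (s ^ (-β) + (1 - s) ^ (-β))) (Set.Ioo 0 1) :=
    IntegrableOn.mono_set (Integrable.const_mul (h1.add h2) A) Set.Ioo_subset_Ioc_self
  have h4 := (integrable_indicator_iff measurableSet_Ioo).mpr h3
  refine (h4.integrableOn (s := Set.Ioi 0)).congr_fun ?_ measurableSet_Ioi
  intro s hs
  have hs : 0 < s := hs
  by_cases h : s < 1
  · simp only [Set.indicator, Set.mem_Ioo, hs, h, and_self, if_true, g0, smul_eq_mul]
    field_simp
  · simp [Set.indicator, h, g0]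


noncomputable def kk {n : ℕ} (Ω : (EuclideanSpace ℝ (Fin n)) → ℝ) (u : EuclideanSpace ℝ (Fin n)) : ℝ := Ω u * W (n - 1) ‖u‖

lemma kk_pt_aux {n : ℕ} (Ω : (EuclideanSpace ℝ (Fin n)) → ℝ) {β C₀ M : ℝ} (hβ0 : 0 < β) (hβ1 : β < 1)
    (hC₀ : 0 < C₀) (hM : 0 ≤ M) (hbd : ∀ u : EuclideanSpace ℝ (Fin n), u ≠ 0 → |Ω u| ≤ M)
    (hlip : ∀ (ξ η : EuclideanSpace ℝ (Fin n)), ξ ≠ 0 → η ≠ 0 →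
      |Ω ξ - Ω η| ≤ C₀ * ‖‖ξ‖⁻¹ • ξ - ‖η‖⁻¹ • η‖ ^ β)
    (u v : EuclideanSpace ℝ (Fin n)) (hu : u ≠ 0) (hv : v ≠ 0) (hu1 : ‖u‖ ≠ 1) (hv1 : ‖v‖ ≠ 1)
    (hW : W (n - 1) ‖v‖ ≤ W (n - 1) ‖u‖) :
    |kk Ω u - kk Ω v| ≤ ‖u - v‖ ^ β *
      (g0 (n - 1) β (C₀ * 2 ^ β + M * (n : ℝ)) ‖u‖ + g0 (n - 1) β (C₀ * 2 ^ β + M * (n : ℝ)) ‖v‖) := by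
  have hu' : 0 < ‖u‖ := norm_pos_iff.mpr hu
  have hv' : 0 < ‖v‖ := norm_pos_iff.mpr hv
  have hn : 1 ≤ n := by
    by_contra h
    have : n = 0 := by omega
    subst this
    exact hu (Subsingleton.elim _ _)
  set A := C₀ * 2 ^ β + M * (n : ℝ) with hA
  have hA0 : 0 ≤ A := by positivity
  have hd : 0 ≤ ‖u - v‖ := norm_nonneg _
  have hdβ : 0 ≤ ‖u - v‖ ^ β := by positivity
  have hsplit : kk Ω u - kk Ω v
      = (Ω u - Ω v) * W (n - 1) ‖v‖ + Ω u * (W (n - 1) ‖u‖ - W (n - 1) ‖v‖) := by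
    unfold kk; ring
  have b1 : |(Ω u - Ω v) * W (n - 1) ‖v‖| ≤ ‖u - v‖ ^ β * g0 (n - 1) β A ‖v‖ := by
    rw [abs_mul, abs_of_nonneg (W_nonneg _ hv'.le)]
    rcases lt_or_gt_of_ne hv1 with h | h
    · have hl : |Ω u - Ω v| ≤ C₀ * (2 * ‖u - v‖ / ‖v‖) ^ β := by
        refine (hlip u v hu hv).trans ?_
        gcongr
        exact unit_diff u v hu hv
      have he : (2 * ‖u - v‖ / ‖v‖) ^ β = 2 ^ β * ‖u - v‖ ^ β * ‖v‖ ^ (-β) := by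
        rw [Real.div_rpow (by positivity) hv'.le, Real.mul_rpow (by norm_num) hd,
          Real.rpow_neg hv'.le]; rfl
      rw [he] at hl
      have hw : W (n - 1) ‖v‖ = (‖v‖ ^ (n - 1))⁻¹ := by simp [W, h.le]
      rw [hw, g0, if_pos h]
      have h1 : 0 ≤ (1 - ‖v‖) ^ (-β) := Real.rpow_nonneg (by linarith) _
      have h2 : C₀ * 2 ^ β * ‖v‖ ^ (-β) ≤ A * (‖v‖ ^ (-β) + (1 - ‖v‖) ^ (-β)) := by
        have : C₀ * 2 ^ β ≤ A := by rw [hA]; have : 0 ≤ M * (n:ℝ) := by positivity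
                                    linarith
        have h3 : ‖v‖ ^ (-β) ≤ ‖v‖ ^ (-β) + (1 - ‖v‖) ^ (-β) := by linarith
        gcongr
      calc _ ≤ (C₀ * (2 ^ β * ‖u - v‖ ^ β * ‖v‖ ^ (-β))) * (‖v‖ ^ (n - 1))⁻¹ := by gcongr
        _ = ‖u - v‖ ^ β * ((C₀ * 2 ^ β * ‖v‖ ^ (-β)) * (‖v‖ ^ (n - 1))⁻¹) := by ring
        _ ≤ ‖u - v‖ ^ β * ((A * (‖v‖ ^ (-β) + (1 - ‖v‖) ^ (-β))) * (‖v‖ ^ (n - 1))⁻¹) := by gcongr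
        _ = _ := by ring
    · have hw : W (n - 1) ‖v‖ = 0 := by simp [W, not_le.mpr h]
      rw [hw, mul_zero]
      exact mul_nonneg hdβ (g0_nonneg _ hA0 hv'.le)
  have b2 : |Ω u * (W (n - 1) ‖u‖ - W (n - 1) ‖v‖)| ≤ ‖u - v‖ ^ β * g0 (n - 1) β A ‖u‖ := by
    rw [abs_mul, abs_of_nonneg (sub_nonneg.mpr hW)]
    rcases lt_or_gt_of_ne hu1 with h | h
    · have hr := radial (n - 1) (d := ‖u - v‖) hβ0 hβ1 hu' h hv' hd (by
        have := norm_sub_norm_le v u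
        rw [norm_sub_rev] at this
        linarith)
      rw [g0, if_pos h]
      have h1 : 0 ≤ (1 - ‖u‖) ^ (-β) := Real.rpow_nonneg (by linarith) _
      have h1' : 0 ≤ ‖u‖ ^ (-β) := by positivity
      have hMA : M * n ≤ A := by rw [hA]; have : 0 ≤ C₀ * (2:ℝ) ^ β := by positivity
                                 linarith
      have h1n : (1:ℝ) ≤ n := by exact_mod_cast hn
      have hnn : ((n - 1 : ℕ) : ℝ) ≤ n := by exact_mod_cast Nat.sub_le _ _
      have h2 : M * ((n - 1 : ℕ) * ‖u‖ ^ (-β) + (1 - ‖u‖) ^ (-β))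
          ≤ A * (‖u‖ ^ (-β) + (1 - ‖u‖) ^ (-β)) := by
        calc _ ≤ M * (n * ‖u‖ ^ (-β) + n * (1 - ‖u‖) ^ (-β)) := by
              gcongr
              nlinarith
          _ = M * n * (‖u‖ ^ (-β) + (1 - ‖u‖) ^ (-β)) := by ring
          _ ≤ _ := by gcongr
      calc _ ≤ M * (‖u - v‖ ^ β * (((n - 1 : ℕ) * ‖u‖ ^ (-β) + (1 - ‖u‖) ^ (-β)) * (‖u‖ ^ (n - 1))⁻¹)) := by
            apply mul_le_mul (hbd u hu) hr (sub_nonneg.mpr hW) hM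
        _ = ‖u - v‖ ^ β * ((M * ((n - 1 : ℕ) * ‖u‖ ^ (-β) + (1 - ‖u‖) ^ (-β))) * (‖u‖ ^ (n - 1))⁻¹) := by ring
        _ ≤ ‖u - v‖ ^ β * ((A * (‖u‖ ^ (-β) + (1 - ‖u‖) ^ (-β))) * (‖u‖ ^ (n - 1))⁻¹) := by gcongr
        _ = _ := by ring
    · have hw : W (n - 1) ‖u‖ = 0 := by simp [W, not_le.mpr h]
      have hw2 : W (n - 1) ‖u‖ - W (n - 1) ‖v‖ ≤ 0 := by
        rw [hw]; have := W_nonneg (n - 1) hv'.le; linarith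
      have hw3 : W (n - 1) ‖u‖ - W (n - 1) ‖v‖ = 0 := le_antisymm hw2 (sub_nonneg.mpr hW)
      rw [hw3, mul_zero]
      exact mul_nonneg hdβ (g0_nonneg _ hA0 hu'.le)
  rw [hsplit]
  refine (abs_add_le _ _).trans ?_
  rw [mul_add]
  linarith

lemma kk_pt {n : ℕ} (Ω : (EuclideanSpace ℝ (Fin n)) → ℝ) {β C₀ M : ℝ} (hβ0 : 0 < β) (hβ1 : β < 1)
    (hC₀ : 0 < C₀) (hM : 0 ≤ M) (hbd : ∀ u : EuclideanSpace ℝ (Fin n), u ≠ 0 → |Ω u| ≤ M)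
    (hlip : ∀ (ξ η : EuclideanSpace ℝ (Fin n)), ξ ≠ 0 → η ≠ 0 →
      |Ω ξ - Ω η| ≤ C₀ * ‖‖ξ‖⁻¹ • ξ - ‖η‖⁻¹ • η‖ ^ β)
    (u v : EuclideanSpace ℝ (Fin n)) (hu : u ≠ 0) (hv : v ≠ 0) (hu1 : ‖u‖ ≠ 1) (hv1 : ‖v‖ ≠ 1) :
    |kk Ω u - kk Ω v| ≤ ‖u - v‖ ^ β *
      (g0 (n - 1) β (C₀ * 2 ^ β + M * (n : ℝ)) ‖u‖ + g0 (n - 1) β (C₀ * 2 ^ β + M * (n : ℝ)) ‖v‖) := by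
  rcases le_total (W (n - 1) ‖v‖) (W (n - 1) ‖u‖) with h | h
  · exact kk_pt_aux Ω hβ0 hβ1 hC₀ hM hbd hlip u v hu hv hu1 hv1 h
  · have := kk_pt_aux Ω hβ0 hβ1 hC₀ hM hbd hlip v u hv hu hv1 hu1 h
    rwa [abs_sub_comm, norm_sub_rev, add_comm (g0 _ _ _ ‖v‖)] at this

lemma Om_cont {n : ℕ} (Ω : (EuclideanSpace ℝ (Fin n)) → ℝ) {β C₀ : ℝ} (hβ0 : 0 < β)
    (hlip : ∀ (ξ η : EuclideanSpace ℝ (Fin n)), ξ ≠ 0 → η ≠ 0 →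
      |Ω ξ - Ω η| ≤ C₀ * ‖‖ξ‖⁻¹ • ξ - ‖η‖⁻¹ • η‖ ^ β) : Measurable Ω := by
  refine measurable_of_continuousOn_compl_singleton 0 ?_
  intro x hx
  have hx : x ≠ 0 := hx
  apply ContinuousAt.continuousWithinAt
  rw [ContinuousAt, tendsto_iff_dist_tendsto_zero]
  have hc : Filter.Tendsto (fun y : EuclideanSpace ℝ (Fin n) => C₀ * ‖‖y‖⁻¹ • y - ‖x‖⁻¹ • x‖ ^ β) (nhds x) (nhds 0) := by
    have h1 : ContinuousAt (fun y : EuclideanSpace ℝ (Fin n) => C₀ * ‖‖y‖⁻¹ • y - ‖x‖⁻¹ • x‖ ^ β) x := by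
      have : ‖x‖ ≠ 0 := norm_ne_zero_iff.mpr hx
      have h2 : ContinuousAt (fun y : EuclideanSpace ℝ (Fin n) => ‖y‖⁻¹) x := continuous_norm.continuousAt.inv₀ this
      exact ContinuousAt.mul continuousAt_const
        ((((h2.smul continuousAt_id).sub continuousAt_const).norm).rpow_const (Or.inr hβ0.le))
    have := h1.tendsto
    simpa [Real.zero_rpow hβ0.ne'] using this
  refine squeeze_zero' (Filter.Eventually.of_forall fun _ => dist_nonneg) ?_ hc
  filter_upwards [isOpen_ne.mem_nhds hx] with y hy
  rw [Real.dist_eq]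
  exact hlip y x hy hx

lemma Om_bdd {n : ℕ} (Ω : (EuclideanSpace ℝ (Fin n)) → ℝ) {β C₀ : ℝ} (hβ0 : 0 < β) (hC₀ : 0 < C₀)
    (hlip : ∀ (ξ η : EuclideanSpace ℝ (Fin n)), ξ ≠ 0 → η ≠ 0 →
      |Ω ξ - Ω η| ≤ C₀ * ‖‖ξ‖⁻¹ • ξ - ‖η‖⁻¹ • η‖ ^ β) :
    ∃ M : ℝ, 0 ≤ M ∧ ∀ u : EuclideanSpace ℝ (Fin n), u ≠ 0 → |Ω u| ≤ M := by
  by_cases h : ∃ e : EuclideanSpace ℝ (Fin n), e ≠ 0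
  · obtain ⟨e, he⟩ := h
    refine ⟨|Ω e| + C₀ * 2 ^ β, by positivity, fun u hu => ?_⟩
    have h1 := hlip u e hu he
    have h2 : ‖‖u‖⁻¹ • u - ‖e‖⁻¹ • e‖ ≤ 2 := by
      refine (norm_sub_le _ _).trans ?_
      rw [norm_smul, norm_smul, norm_inv, norm_inv, norm_norm, norm_norm,
        inv_mul_cancel₀ (norm_ne_zero_iff.mpr hu), inv_mul_cancel₀ (norm_ne_zero_iff.mpr he)]
      norm_num
    have h3 : C₀ * ‖‖u‖⁻¹ • u - ‖e‖⁻¹ • e‖ ^ β ≤ C₀ * 2 ^ β := by gcongr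
    have h4 : |Ω u| ≤ |Ω u - Ω e| + |Ω e| := by
      have := abs_add_le (Ω u - Ω e) (Ω e)
      simpa using this
    linarith
  · push Not at h
    exact ⟨0, le_rfl, fun u hu => absurd (h u) hu⟩

lemma kk_meas {n : ℕ} (Ω : (EuclideanSpace ℝ (Fin n)) → ℝ) (h : Measurable Ω) : Measurable (kk Ω) := by
  unfold kk W
  refine h.mul (Measurable.ite ?_ ?_ measurable_const)
  · exact measurableSet_le measurable_norm measurable_const
  · fun_prop

lemma ae_good {n : ℕ} (hn : 1 ≤ n) : ∀ᵐ u : EuclideanSpace ℝ (Fin n), u ≠ 0 ∧ ‖u‖ ≠ 1 := by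
  have : Nonempty (Fin n) := ⟨⟨0, hn⟩⟩
  have h1 : ∀ᵐ u : EuclideanSpace ℝ (Fin n), u ≠ 0 := by
    simp [ae_iff]
  have h2 : ∀ᵐ u : EuclideanSpace ℝ (Fin n), ‖u‖ ≠ 1 := by
    have := Measure.addHaar_sphere (volume : Measure (EuclideanSpace ℝ (Fin n))) 0 1
    rw [ae_iff]
    convert this using 2
    ext u; simp
  filter_upwards [h1, h2] with u a b using ⟨a, b⟩

lemma kk_int_zero {n : ℕ} (Ω : (EuclideanSpace ℝ (Fin n)) → ℝ)
    (hhom : ∀ (l : ℝ), 0 < l → ∀ y : EuclideanSpace ℝ (Fin n), Ω (l • y) = Ω y)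
    (hvan : ∫ z : sphere (0 : EuclideanSpace ℝ (Fin n)) 1, Ω (z : EuclideanSpace ℝ (Fin n)) ∂(volume : Measure (EuclideanSpace ℝ (Fin n))).toSphere = 0)
    (hn : 1 ≤ n) : ∫ u, kk Ω u = 0 := by
  have : Nonempty (Fin n) := ⟨⟨0, hn⟩⟩
  calc ∫ u, kk Ω u = ∫ x : ({(0 : EuclideanSpace ℝ (Fin n))}ᶜ : Set (EuclideanSpace ℝ (Fin n))), kk Ω x.1 ∂((volume : Measure (EuclideanSpace ℝ (Fin n))).comap (↑)) := by
        rw [integral_subtype_comap (measurableSet_singleton _).compl fun x ↦ kk Ω x,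
          restrict_compl_singleton]
    _ = ∫ p : (sphere (0 : EuclideanSpace ℝ (Fin n)) 1) × (Set.Ioi (0:ℝ)), Ω p.1 * W (n - 1) p.2
          ∂((volume : Measure (EuclideanSpace ℝ (Fin n))).toSphere.prod (.volumeIoiPow (Module.finrank ℝ (EuclideanSpace ℝ (Fin n)) - 1))) := by
        rw [← (volume : Measure (EuclideanSpace ℝ (Fin n))).measurePreserving_homeomorphUnitSphereProd.integral_comp
          (Homeomorph.measurableEmbedding _)]
        apply integral_congr_ae
        refine Filter.Eventually.of_forall ?_
        rintro ⟨x, hx⟩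
        have hx : x ≠ 0 := hx
        simp only [kk, homeomorphUnitSphereProd_apply_fst_coe, homeomorphUnitSphereProd_apply_snd_coe]
        rw [hhom _ (inv_pos.mpr (norm_pos_iff.mpr hx))]
    _ = 0 := by
        rw [integral_prod_mul (fun z : sphere (0 : EuclideanSpace ℝ (Fin n)) 1 => Ω z)
          (fun s : Set.Ioi (0:ℝ) => W (n - 1) s), hvan, zero_mul]

lemma kk_integrable {n : ℕ} (Ω : (EuclideanSpace ℝ (Fin n)) → ℝ) {β C₀ M : ℝ} (hn : 1 ≤ n) (hβ0 : 0 < β) (hβ1 : β < 1)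
    (hC₀ : 0 < C₀) (hM : 0 ≤ M) (hbd : ∀ u : EuclideanSpace ℝ (Fin n), u ≠ 0 → |Ω u| ≤ M) (hm : Measurable Ω) :
    Integrable (kk Ω) := by
  refine (g0_integrable hn (A := C₀ * 2 ^ β + M * (n : ℝ)) hβ0 hβ1).mono'
    (kk_meas Ω hm).aestronglyMeasurable ?_
  filter_upwards [ae_good hn] with u hu
  have hu' : 0 < ‖u‖ := norm_pos_iff.mpr hu.1
  rw [Real.norm_eq_abs, kk, abs_mul, abs_of_nonneg (W_nonneg _ hu'.le)]
  rcases lt_or_gt_of_ne hu.2 with h | h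
  · rw [g0, if_pos h, W, if_pos h.le, ← mul_assoc]
    have h1n : (1:ℝ) ≤ n := by exact_mod_cast hn
    have h1 : 0 ≤ (1 - ‖u‖) ^ (-β) := Real.rpow_nonneg (by linarith) _
    have h2 : 1 ≤ ‖u‖ ^ (-β) := Real.one_le_rpow_of_pos_of_le_one_of_nonpos hu' h.le (by linarith)
    gcongr
    have : M ≤ C₀ * 2 ^ β + M * (n : ℝ) := by
      have : 0 ≤ C₀ * (2:ℝ) ^ β := by positivity
      nlinarith
    calc |Ω u| ≤ M := hbd u hu.1
      _ = M * 1 := by ring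
      _ ≤ _ := by
        apply mul_le_mul this (by linarith) zero_le_one (by linarith)
  · have hw : W (n - 1) ‖u‖ = 0 := by simp [W, not_le.mpr h]
    rw [hw, mul_zero]
    exact g0_nonneg _ (by positivity) hu'.le

lemma kk_L1 {n : ℕ} (Ω : (EuclideanSpace ℝ (Fin n)) → ℝ) {β C₀ M : ℝ} (hn : 1 ≤ n) (hβ0 : 0 < β) (hβ1 : β < 1)
    (hC₀ : 0 < C₀) (hM : 0 ≤ M) (hbd : ∀ u : EuclideanSpace ℝ (Fin n), u ≠ 0 → |Ω u| ≤ M)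
    (hlip : ∀ (ξ η : EuclideanSpace ℝ (Fin n)), ξ ≠ 0 → η ≠ 0 →
      |Ω ξ - Ω η| ≤ C₀ * ‖‖ξ‖⁻¹ • ξ - ‖η‖⁻¹ • η‖ ^ β) (δ : EuclideanSpace ℝ (Fin n)) :
    ∫ u, |kk Ω (u + δ) - kk Ω u| ≤
      (2 * ∫ u : EuclideanSpace ℝ (Fin n), g0 (n - 1) β (C₀ * 2 ^ β + M * (n : ℝ)) ‖u‖) * ‖δ‖ ^ β := by
  have hk := kk_integrable Ω hn hβ0 hβ1 hC₀ hM hbd (Om_cont Ω hβ0 hlip)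
  have hg := g0_integrable hn (A := C₀ * 2 ^ β + M * (n : ℝ)) hβ0 hβ1
  have hgood := ae_good hn
  have hgood' : ∀ᵐ u : EuclideanSpace ℝ (Fin n), u + δ ≠ 0 ∧ ‖u + δ‖ ≠ 1 :=
    (quasiMeasurePreserving_add_right volume δ).ae hgood
  calc ∫ u, |kk Ω (u + δ) - kk Ω u| ≤ ∫ u : EuclideanSpace ℝ (Fin n), ‖δ‖ ^ β *
        (g0 (n - 1) β (C₀ * 2 ^ β + M * (n : ℝ)) ‖u + δ‖ +
          g0 (n - 1) β (C₀ * 2 ^ β + M * (n : ℝ)) ‖u‖) := by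
        apply integral_mono_ae
        · exact ((hk.comp_add_right δ).sub hk).abs
        · exact ((hg.comp_add_right δ).add hg).const_mul _
        · filter_upwards [hgood, hgood'] with u h1 h2
          have := kk_pt Ω hβ0 hβ1 hC₀ hM hbd hlip (u + δ) u h2.1 h1.1 h2.2 h1.2
          simpa using this
    _ = _ := by
        rw [integral_const_mul, integral_add (hg.comp_add_right δ) hg,
          integral_add_right_eq_self (fun u : EuclideanSpace ℝ (Fin n) => g0 (n - 1) β (C₀ * 2 ^ β + M * (n : ℝ)) ‖u‖) δ]
        ring

lemma kk_scale {n : ℕ} (Ω : (EuclideanSpace ℝ (Fin n)) → ℝ) (hn : 1 ≤ n)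
    (hhom : ∀ (l : ℝ), 0 < l → ∀ y : EuclideanSpace ℝ (Fin n), Ω (l • y) = Ω y) (f : (EuclideanSpace ℝ (Fin n)) → ℝ) (x : EuclideanSpace ℝ (Fin n))
    {t : ℝ} (ht : 0 < t) :
    ∫ y in closedBall (0 : EuclideanSpace ℝ (Fin n)) t, Ω y / ‖y‖ ^ ((n : ℝ) - 1) * f (x - y)
      = t * ∫ u, kk Ω u * f (x - t • u) := by
  rw [← integral_indicator measurableSet_closedBall]
  set φ : (EuclideanSpace ℝ (Fin n)) → ℝ := (closedBall (0 : EuclideanSpace ℝ (Fin n)) t).indicator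
    (fun y => Ω y / ‖y‖ ^ ((n : ℝ) - 1) * f (x - y)) with hφ
  have h := Measure.integral_comp_smul (volume : Measure (EuclideanSpace ℝ (Fin n))) φ t
  rw [finrank_euclideanSpace_fin, abs_of_pos (by positivity), smul_eq_mul] at h
  have h2 : ∀ u : EuclideanSpace ℝ (Fin n), φ (t • u) = (t ^ (n - 1))⁻¹ * (kk Ω u * f (x - t • u)) := by
    intro u
    have hmem : t • u ∈ closedBall (0 : EuclideanSpace ℝ (Fin n)) t ↔ ‖u‖ ≤ 1 := by
      rw [mem_closedBall_zero_iff, norm_smul, Real.norm_eq_abs, abs_of_pos ht]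
      constructor
      · intro h; nlinarith
      · intro h; nlinarith
    have hp : ((n : ℝ) - 1) = ((n - 1 : ℕ) : ℝ) := by push_cast [hn]; ring
    by_cases hu : ‖u‖ ≤ 1
    · rw [hφ, Set.indicator_of_mem (hmem.mpr hu), kk, W, if_pos hu, hhom t ht, hp,
        Real.rpow_natCast, norm_smul, Real.norm_eq_abs, abs_of_pos ht, mul_pow, div_eq_mul_inv,
        mul_inv]
      ring
    · rw [hφ, Set.indicator_of_notMem (fun h => hu (hmem.mp h)), kk, W, if_neg hu]
      ring
  simp_rw [h2] at h
  rw [integral_const_mul] at h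
  have hnn : t ^ n = t ^ (n - 1) * t := by
    rw [← pow_succ]; congr 1; omega
  rw [hnn] at h
  have : (0:ℝ) < t ^ (n - 1) := by positivity
  field_simp at h
  linarith

/-- Kernel summary. -/
structure Ker {n : ℕ} (β A : ℝ) (k : (EuclideanSpace ℝ (Fin n)) → ℝ) : Prop where
  meas : Measurable k
  int : Integrable k
  zero : ∫ u, k u = 0
  supp : ∀ u, 1 < ‖u‖ → k u = 0
  l1 : ∫ u, |k u| ≤ A
  mod : ∀ δ : EuclideanSpace ℝ (Fin n), ∫ u, |k (u + δ) - k u| ≤ A * ‖δ‖ ^ β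

lemma kk_ker {n : ℕ} (Ω : (EuclideanSpace ℝ (Fin n)) → ℝ) {β C₀ : ℝ} (hn : 1 ≤ n) (hβ0 : 0 < β) (hβ1 : β < 1)
    (hC₀ : 0 < C₀)
    (hhom : ∀ (l : ℝ), 0 < l → ∀ y : EuclideanSpace ℝ (Fin n), Ω (l • y) = Ω y)
    (hlip : ∀ (ξ η : EuclideanSpace ℝ (Fin n)), ξ ≠ 0 → η ≠ 0 →
      |Ω ξ - Ω η| ≤ C₀ * ‖‖ξ‖⁻¹ • ξ - ‖η‖⁻¹ • η‖ ^ β)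
    (hvan : ∫ z : sphere (0 : EuclideanSpace ℝ (Fin n)) 1, Ω (z : EuclideanSpace ℝ (Fin n)) ∂(volume : Measure (EuclideanSpace ℝ (Fin n))).toSphere = 0) :
    ∃ A : ℝ, ∀ A' ≥ A, Ker β A' (kk Ω) := by
  obtain ⟨M, hM, hbd⟩ := Om_bdd Ω hβ0 hC₀ hlip
  have hm := Om_cont Ω hβ0 hlip
  refine ⟨max (∫ u, |kk Ω u|) (2 * ∫ u : EuclideanSpace ℝ (Fin n), g0 (n - 1) β (C₀ * 2 ^ β + M * (n : ℝ)) ‖u‖),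
    fun A' hA' => ⟨kk_meas Ω hm, kk_integrable Ω hn hβ0 hβ1 hC₀ hM hbd hm,
      kk_int_zero Ω hhom hvan hn, ?_, (le_max_left _ _).trans hA', ?_⟩⟩
  · intro u hu
    simp [kk, W, not_le.mpr hu]
  · intro δ
    refine (kk_L1 Ω hn hβ0 hβ1 hC₀ hM hbd hlip δ).trans ?_
    gcongr
    exact (le_max_right _ _).trans hA'

lemma holder_cont {n : ℕ} {f : (EuclideanSpace ℝ (Fin n)) → ℝ} {L a : ℝ} (ha : 0 < a)
    (hf : ∀ x y, |f x - f y| ≤ L * ‖x - y‖ ^ a) : Continuous f := by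
  rw [continuous_iff_continuousAt]
  intro x
  rw [ContinuousAt, tendsto_iff_dist_tendsto_zero]
  have hc : Filter.Tendsto (fun y : EuclideanSpace ℝ (Fin n) => L * ‖y - x‖ ^ a) (nhds x) (nhds 0) := by
    have h1 : Continuous (fun y : EuclideanSpace ℝ (Fin n) => L * ‖y - x‖ ^ a) :=
      continuous_const.mul ((continuous_id.sub continuous_const).norm.rpow_const
        (fun _ => Or.inr ha.le))
    simpa [Real.zero_rpow ha.ne'] using h1.tendsto x
  exact squeeze_zero (fun _ => dist_nonneg) (fun y => by rw [Real.dist_eq]; exact hf y x) hc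

lemma osc {n : ℕ} {f : (EuclideanSpace ℝ (Fin n)) → ℝ} {L a : ℝ} (hL : 0 ≤ L) (ha : 0 < a)
    (hf : ∀ x y, |f x - f y| ≤ L * ‖x - y‖ ^ a) (x u : EuclideanSpace ℝ (Fin n)) {t R : ℝ} (ht : 0 < t)
    (hu : ‖u‖ ≤ R) : |f (x - t • u) - f x| ≤ L * (t * R) ^ a := by
  refine (hf _ _).trans ?_
  gcongr
  rw [sub_sub_cancel_left, norm_neg, norm_smul, Real.norm_eq_abs, abs_of_pos ht]
  gcongr

lemma prod_int {n : ℕ} {β A : ℝ} {k : (EuclideanSpace ℝ (Fin n)) → ℝ} (hk : Ker β A k)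
    {f : (EuclideanSpace ℝ (Fin n)) → ℝ} {L a : ℝ} (hL : 0 ≤ L) (ha : 0 < a)
    (hf : ∀ x y, |f x - f y| ≤ L * ‖x - y‖ ^ a) (x : EuclideanSpace ℝ (Fin n)) {t : ℝ} (ht : 0 < t) (c : ℝ) :
    Integrable (fun u => k u * (f (x - t • u) - c)) := by
  have hfc := holder_cont ha hf
  have h1 : Integrable (fun u => k u * (f (x - t • u) - f x)) := by
    refine (hk.int.abs.mul_const (L * (t * 1) ^ a)).mono' ?_ ?_
    · exact (hk.meas.mul (by fun_prop)).aestronglyMeasurable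
    · refine Filter.Eventually.of_forall fun u => ?_
      rw [Real.norm_eq_abs, abs_mul]
      by_cases hu : ‖u‖ ≤ 1
      · gcongr
        exact osc hL ha hf x u ht hu
      · simp [hk.supp u (not_le.mp hu)]
  refine (h1.add (hk.int.mul_const (f x - c))).congr (Filter.Eventually.of_forall fun u => ?_)
  simp only [Pi.add_apply]; ring

lemma G_sub {n : ℕ} {β A : ℝ} {k : (EuclideanSpace ℝ (Fin n)) → ℝ} (hk : Ker β A k)
    {f : (EuclideanSpace ℝ (Fin n)) → ℝ} {L a : ℝ} (hL : 0 ≤ L) (ha : 0 < a)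
    (hf : ∀ x y, |f x - f y| ≤ L * ‖x - y‖ ^ a) (x : EuclideanSpace ℝ (Fin n)) {t : ℝ} (ht : 0 < t) (c : ℝ) :
    ∫ u, k u * f (x - t • u) = ∫ u, k u * (f (x - t • u) - c) := by
  have h0 : ∀ u, k u * f (x - t • u) = k u * (f (x - t • u) - c) + k u * c := fun u => by ring
  simp_rw [h0]
  rw [integral_add (prod_int hk hL ha hf x ht c) (hk.int.mul_const c), integral_mul_const, hk.zero]
  ring

lemma G_bound {n : ℕ} {β A : ℝ} {k : (EuclideanSpace ℝ (Fin n)) → ℝ} (hk : Ker β A k)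
    {f : (EuclideanSpace ℝ (Fin n)) → ℝ} {L a : ℝ} (hL : 0 ≤ L) (ha : 0 < a)
    (hf : ∀ x y, |f x - f y| ≤ L * ‖x - y‖ ^ a) (x : EuclideanSpace ℝ (Fin n)) {t : ℝ} (ht : 0 < t) :
    |∫ u, k u * f (x - t • u)| ≤ A * L * t ^ a := by
  rw [G_sub hk hL ha hf x ht (f x)]
  calc |∫ u, k u * (f (x - t • u) - f x)| ≤ ∫ u, |k u| * (L * t ^ a) := by
        rw [← Real.norm_eq_abs]
        apply norm_integral_le_of_norm_le (hk.int.abs.mul_const _)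
        refine Filter.Eventually.of_forall fun u => ?_
        rw [Real.norm_eq_abs, abs_mul]
        by_cases hu : ‖u‖ ≤ 1
        · gcongr
          simpa using osc hL ha hf x u ht hu
        · simp [hk.supp u (not_le.mp hu)]
    _ = (∫ u, |k u|) * (L * t ^ a) := integral_mul_const _ _
    _ ≤ A * (L * t ^ a) := by
        gcongr; exact hk.l1
    _ = _ := by ring

lemma G_diff {n : ℕ} {β A : ℝ} {k : (EuclideanSpace ℝ (Fin n)) → ℝ} (hk : Ker β A k)
    {f : (EuclideanSpace ℝ (Fin n)) → ℝ} {L a : ℝ} (hL : 0 ≤ L) (ha : 0 < a) (ha1 : a < 1)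
    (hf : ∀ x y, |f x - f y| ≤ L * ‖x - y‖ ^ a) (x x' : EuclideanSpace ℝ (Fin n)) {t : ℝ} (ht : 0 < t)
    (hr : ‖x' - x‖ ≤ t) :
    |(∫ u, k u * f (x' - t • u)) - ∫ u, k u * f (x - t • u)|
      ≤ A * L * t ^ a * (2 * (‖x' - x‖ / t) ^ β) := by
  set δ : EuclideanSpace ℝ (Fin n) := t⁻¹ • (x' - x) with hδ
  have hδn : ‖δ‖ = ‖x' - x‖ / t := by
    rw [hδ, norm_smul, Real.norm_eq_abs, abs_of_pos (inv_pos.mpr ht)]; ring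
  have hδ1 : ‖δ‖ ≤ 1 := by rw [hδn, div_le_one ht]; exact hr
  have e1 : ∀ u, k (u + δ) * (f (x' - t • (u + δ)) - f x) = k (u + δ) * (f (x - t • u) - f x) := by
    intro u
    have : x' - t • (u + δ) = x - t • u := by
      rw [hδ, smul_add, smul_smul, mul_inv_cancel₀ ht.ne', one_smul]; abel
    rw [this]
  have hi := prod_int hk hL ha hf x' ht (f x)
  have hi' := hi.comp_add_right δ
  simp_rw [e1] at hi'
  rw [G_sub hk hL ha hf x ht (f x), G_sub hk hL ha hf x' ht (f x),
    ← integral_add_right_eq_self (fun u => k u * (f (x' - t • u) - f x)) δ]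
  simp_rw [e1]
  rw [← integral_sub hi' (prod_int hk hL ha hf x ht (f x))]
  have hkd : Integrable (fun u => |k (u + δ) - k u|) := ((hk.int.comp_add_right δ).sub hk.int).abs
  have h2a : (t * 2) ^ a ≤ t ^ a * 2 := by
    rw [Real.mul_rpow ht.le (by norm_num)]
    gcongr
    calc (2:ℝ) ^ a ≤ 2 ^ (1:ℝ) := Real.rpow_le_rpow_of_exponent_le (by norm_num) ha1.le
      _ = 2 := Real.rpow_one 2
  calc |∫ u, (k (u + δ) * (f (x - t • u) - f x) - k u * (f (x - t • u) - f x))|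
      ≤ ∫ u, |k (u + δ) - k u| * (L * (t ^ a * 2)) := by
        rw [← Real.norm_eq_abs]
        apply norm_integral_le_of_norm_le (hkd.mul_const _)
        refine Filter.Eventually.of_forall fun u => ?_
        rw [← sub_mul, Real.norm_eq_abs, abs_mul]
        by_cases hu : ‖u‖ ≤ 2
        · gcongr
          exact (osc hL ha hf x u ht hu).trans (by gcongr)
        · have hu := not_le.mp hu
          have h3 : ‖u‖ ≤ ‖u + δ‖ + ‖δ‖ := by simpa using norm_sub_le (u + δ) δ
          simp [hk.supp u (by linarith), hk.supp (u + δ) (by linarith)]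
    _ = (∫ u, |k (u + δ) - k u|) * (L * (t ^ a * 2)) := integral_mul_const _ _
    _ ≤ (A * ‖δ‖ ^ β) * (L * (t ^ a * 2)) := by
        gcongr; exact hk.mod δ
    _ = _ := by rw [hδn]; ring

lemma G_meas {n : ℕ} {β A : ℝ} {k : (EuclideanSpace ℝ (Fin n)) → ℝ} (hk : Ker β A k)
    {f : (EuclideanSpace ℝ (Fin n)) → ℝ} (hf : Continuous f) (x : EuclideanSpace ℝ (Fin n)) :
    Measurable (fun t : ℝ => ∫ u, k u * f (x - t • u)) := by
  have : StronglyMeasurable (fun p : ℝ × (EuclideanSpace ℝ (Fin n)) => k p.2 * f (x - p.1 • p.2)) := by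
    apply Measurable.stronglyMeasurable
    exact (hk.meas.comp measurable_snd).mul (by fun_prop)
  exact this.integral_prod_right'.measurable

lemma prod_diff {m : ℕ} (s : Finset (Fin m)) (a b c : Fin m → ℝ) (ε : ℝ)
    (ha : ∀ j, |a j| ≤ c j) (hb : ∀ j, |b j| ≤ c j)
    (hab : ∀ j, |a j - b j| ≤ c j * ε) :
    |∏ j ∈ s, a j - ∏ j ∈ s, b j| ≤ s.card * ε * ∏ j ∈ s, c j := by
  classical
  induction s using Finset.induction_on with
  | empty => simp
  | insert i s hi ih =>
    rw [Finset.prod_insert hi, Finset.prod_insert hi, Finset.prod_insert hi,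
      Finset.card_insert_of_notMem hi]
    have hc : ∀ j, 0 ≤ c j := fun j => (abs_nonneg _).trans (ha j)
    have e : a i * ∏ j ∈ s, a j - b i * ∏ j ∈ s, b j
        = a i * (∏ j ∈ s, a j - ∏ j ∈ s, b j) + (a i - b i) * ∏ j ∈ s, b j := by ring
    rw [e]
    refine (abs_add_le _ _).trans ?_
    rw [abs_mul, abs_mul]
    have h1 : |∏ j ∈ s, b j| ≤ ∏ j ∈ s, c j := by
      rw [Finset.abs_prod]
      exact Finset.prod_le_prod (fun _ _ => abs_nonneg _) (fun j _ => hb j)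
    have h2 : |a i| * |∏ j ∈ s, a j - ∏ j ∈ s, b j| ≤ c i * (s.card * ε * ∏ j ∈ s, c j) :=
      mul_le_mul (ha i) ih (abs_nonneg _) (hc i)
    have h3 : |a i - b i| * |∏ j ∈ s, b j| ≤ c i * ε * ∏ j ∈ s, c j :=
      mul_le_mul (hab i) h1 (abs_nonneg _) ((abs_nonneg _).trans (hab i))
    push_cast
    linarith

/-- the dominating function for the difference -/
noncomputable def DD (α β B r t : ℝ) : ℝ := if t ≤ r then t ^ α else B * (t ^ α * (r / t) ^ β)

lemma DD_lint {α β B r : ℝ} (hα : 0 < α) (hαβ : α < β) (hB : 0 ≤ B) (hr : 0 < r) :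
    ∫⁻ t in Set.Ioi (0:ℝ), ENNReal.ofReal ((DD α β B r t) ^ 2 / t)
      ≤ ENNReal.ofReal ((1 / (2 * α) + B ^ 2 / (2 * β - 2 * α)) * (r ^ α) ^ 2) := by
  have hU : Set.Ioi (0:ℝ) = Set.Ioc 0 r ∪ Set.Ioi r := (Set.Ioc_union_Ioi_eq_Ioi hr.le).symm
  rw [hU]
  refine (lintegral_union_le _ _ _).trans ?_
  have i1 : ∫⁻ t in Set.Ioc 0 r, ENNReal.ofReal ((DD α β B r t) ^ 2 / t)
      = ENNReal.ofReal (1 / (2 * α) * (r ^ α) ^ 2) := by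
    have : ∀ t ∈ Set.Ioc 0 r, ENNReal.ofReal ((DD α β B r t) ^ 2 / t)
        = ENNReal.ofReal (t ^ (2 * α - 1)) := by
      intro t ht
      rw [DD, if_pos ht.2, Real.rpow_sub ht.1, Real.rpow_one, mul_comm 2 α, Real.rpow_mul ht.1.le,
        Real.rpow_two]
    rw [setLIntegral_congr_fun measurableSet_Ioc this,
      ← ofReal_integral_eq_lintegral_ofReal]
    · rw [← intervalIntegral.integral_of_le hr.le, integral_rpow (Or.inl (by linarith)),
        sub_add_cancel, Real.zero_rpow (by linarith), mul_comm 2 α, Real.rpow_mul hr.le,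
        Real.rpow_two]
      congr 1; ring
    · have := intervalIntegral.intervalIntegrable_rpow' (a := 0) (b := r) (r := 2 * α - 1)
        (by linarith)
      rwa [intervalIntegrable_iff_integrableOn_Ioc_of_le hr.le] at this
    · refine (ae_restrict_iff' measurableSet_Ioc).mpr (Filter.Eventually.of_forall fun t ht => ?_)
      exact Real.rpow_nonneg ht.1.le _
  have i2 : ∫⁻ t in Set.Ioi r, ENNReal.ofReal ((DD α β B r t) ^ 2 / t)
      = ENNReal.ofReal (B ^ 2 / (2 * β - 2 * α) * (r ^ α) ^ 2) := by
    have : ∀ t ∈ Set.Ioi r, ENNReal.ofReal ((DD α β B r t) ^ 2 / t)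
        = ENNReal.ofReal (B ^ 2 * r ^ (2 * β) * t ^ (2 * α - 2 * β - 1)) := by
      intro t ht
      have ht : r < t := ht
      have ht0 : 0 < t := hr.trans ht
      rw [DD, if_neg (not_le.mpr ht), Real.rpow_sub ht0, Real.rpow_sub ht0, Real.rpow_one,
        mul_comm 2 α, mul_comm 2 β, Real.rpow_mul ht0.le, Real.rpow_mul ht0.le, Real.rpow_mul hr.le,
        Real.rpow_two, Real.rpow_two, Real.rpow_two, Real.div_rpow hr.le ht0.le]
      congr 1; field_simp
    rw [setLIntegral_congr_fun measurableSet_Ioi this,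
      ← ofReal_integral_eq_lintegral_ofReal]
    · rw [integral_const_mul, integral_Ioi_rpow_of_lt (by linarith) hr, sub_add_cancel,
        Real.rpow_sub hr, mul_comm 2 α, mul_comm 2 β, Real.rpow_mul hr.le, Real.rpow_mul hr.le,
        Real.rpow_two, Real.rpow_two]
      congr 1
      have h1 : α * 2 - β * 2 ≠ 0 := by linarith
      have h2 : β * 2 - α * 2 ≠ 0 := by linarith
      have h3 : r ^ β ≠ 0 := by positivity
      have : α * 2 - β * 2 = -(β * 2 - α * 2) := by ring
      rw [this]
      field_simp
    · exact (integrableOn_Ioi_rpow_of_lt (by linarith) hr).const_mul _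
    · refine (ae_restrict_iff' measurableSet_Ioi).mpr (Filter.Eventually.of_forall fun t ht => ?_)
      have ht0 : 0 < t := hr.trans ht
      simp only [Pi.zero_apply]; positivity
  rw [i1, i2, ← ENNReal.ofReal_add, ← add_mul]
  · positivity
  · have : 0 < 2 * β - 2 * α := by linarith
    positivity

lemma minkowski {H H' D : ℝ → ℝ} {Q : ℝ} (hH' : Measurable H')
    (hD : Measurable D) (hQ : 0 ≤ Q)
    (hle : ∀ t > 0, |H t| ≤ |H' t| + D t)
    (hD0 : ∀ t > 0, 0 ≤ D t)
    (hint : ∫⁻ t in Set.Ioi (0:ℝ), ENNReal.ofReal ((D t) ^ 2 / t) ≤ ENNReal.ofReal (Q ^ 2)) :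
    (∫⁻ t in Set.Ioi (0:ℝ), ENNReal.ofReal ((H t) ^ 2 / t)) ^ (1 / 2 : ℝ)
     ≤ (∫⁻ t in Set.Ioi (0:ℝ), ENNReal.ofReal ((H' t) ^ 2 / t)) ^ (1 / 2 : ℝ) + ENNReal.ofReal Q := by
  have conv : ∀ (F : ℝ → ℝ), ∀ t ∈ Set.Ioi (0:ℝ), ENNReal.ofReal ((F t) ^ 2 / t)
      = (ENNReal.ofReal (|F t| / Real.sqrt t)) ^ (2:ℝ) := by
    intro F t ht
    have ht : 0 < t := ht
    rw [ENNReal.ofReal_rpow_of_nonneg (by positivity) (by norm_num), Real.rpow_two, div_pow,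
      sq_abs, Real.sq_sqrt ht.le]
  set φ := fun t => ENNReal.ofReal (|H' t| / Real.sqrt t) with hφ
  set ψ := fun t => ENNReal.ofReal (|D t| / Real.sqrt t) with hψ
  have hφm : Measurable φ := by
    have := Real.continuous_sqrt.measurable
    exact ((measurable_norm.comp hH').div this).ennreal_ofReal
  have hψm : Measurable ψ := by
    have := Real.continuous_sqrt.measurable
    exact ((measurable_norm.comp hD).div this).ennreal_ofReal
  calc _ ≤ (∫⁻ t in Set.Ioi (0:ℝ), (φ + ψ) t ^ (2:ℝ)) ^ (1 / 2 : ℝ) := by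
        gcongr ?_ ^ _
        apply setLIntegral_mono' measurableSet_Ioi
        intro t ht
        rw [conv H t ht]
        gcongr ?_ ^ _
        simp only [Pi.add_apply, hφ, hψ]
        rw [← ENNReal.ofReal_add (by positivity) (by positivity), ← add_div,
          abs_of_nonneg (hD0 t ht)]
        gcongr
        exact hle t ht
    _ ≤ (∫⁻ t in Set.Ioi (0:ℝ), φ t ^ (2:ℝ)) ^ (1 / 2 : ℝ)
        + (∫⁻ t in Set.Ioi (0:ℝ), ψ t ^ (2:ℝ)) ^ (1 / 2 : ℝ) :=
        ENNReal.lintegral_Lp_add_le hφm.aemeasurable hψm.aemeasurable (by norm_num)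
    _ ≤ _ := by
        rw [setLIntegral_congr_fun measurableSet_Ioi (conv H')]
        gcongr
        rw [setLIntegral_congr_fun measurableSet_Ioi (conv D)] at hint
        calc _ ≤ (ENNReal.ofReal (Q ^ 2)) ^ (1 / 2 : ℝ) := by gcongr
          _ = ENNReal.ofReal Q := by
            rw [ENNReal.ofReal_rpow_of_nonneg (by positivity) (by norm_num), ← Real.sqrt_eq_rpow,
              Real.sqrt_sq hQ]

end MI

lemma MI.lip_bound {n : ℕ} {γ : ℝ} (hγ : 0 < γ) {f : EuclideanSpace ℝ (Fin n) → ℝ}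
    (h : lipNorm n γ f < ⊤) (x y : EuclideanSpace ℝ (Fin n)) :
    |f x - f y| ≤ (lipNorm n γ f).toReal * ‖x - y‖ ^ γ := by
  by_cases hxy : x = y
  · subst hxy; simp [Real.zero_rpow hγ.ne']
  · have h1 : ENNReal.ofReal (|f x - f y| / ‖x - y‖ ^ γ) ≤ lipNorm n γ f := by
      unfold lipNorm
      exact le_iSup_of_le x (le_iSup_of_le y (le_iSup_of_le hxy le_rfl))
    have h2 := (ENNReal.ofReal_le_iff_le_toReal h.ne).mp h1
    have : 0 < ‖x - y‖ ^ γ := Real.rpow_pos_of_pos (norm_pos_iff.mpr (sub_ne_zero.mpr hxy)) _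
    rwa [div_le_iff₀ this] at h2

/-- Lipschitz space boundedness of the separated multilinear
Marcinkiewicz integral, with 0 < α_j < 1/m. -/
theorem stmt16 (n m : ℕ) (hn : 1 ≤ n) (hm : 1 ≤ m)
    (Ω : Fin m → EuclideanSpace ℝ (Fin n) → ℝ)
    (β C₀ : ℝ) (hβ0 : 0 < β) (hβ1 : β < 1) (hC₀ : 0 < C₀)
    (hΩhom : ∀ (j : Fin m) (l : ℝ), 0 < l → ∀ y : EuclideanSpace ℝ (Fin n),
      Ω j (l • y) = Ω j y)
    (hΩlip : ∀ (j : Fin m) (ξ η : EuclideanSpace ℝ (Fin n)), ξ ≠ 0 → η ≠ 0 →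
      |Ω j ξ - Ω j η| ≤ C₀ * ‖‖ξ‖⁻¹ • ξ - ‖η‖⁻¹ • η‖ ^ β)
    (hΩvan : ∀ j : Fin m,
      ∫ z : sphere (0 : EuclideanSpace ℝ (Fin n)) 1, Ω j (z : EuclideanSpace ℝ (Fin n))
        ∂(volume : Measure (EuclideanSpace ℝ (Fin n))).toSphere = 0)
    (α : Fin m → ℝ) (hα0 : ∀ j, 0 < α j) (hα1 : ∀ j, α j < 1 / (m : ℝ))
    (hαsum0 : 0 < ∑ j, α j) (hαsumβ : (∑ j, α j) < β / 2) :
    ∃ C > (0 : ℝ), ∀ f : Fin m → EuclideanSpace ℝ (Fin n) → ℝ,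
      (∀ j, LocallyIntegrable (f j) volume) →
      (∀ j, lipNorm n (α j) (f j) < ⊤) →
      (∀ x : EuclideanSpace ℝ (Fin n), smarc n m Ω f x = ⊤) ∨
      ((∀ᵐ x : EuclideanSpace ℝ (Fin n), smarc n m Ω f x < ⊤) ∧
        lipNorm n (∑ j, α j) (fun x => (smarc n m Ω f x).toReal) ≤
          ENNReal.ofReal C * ∏ j, lipNorm n (α j) (f j)) := by
  classical
  have hk : ∀ j, ∃ A : ℝ, ∀ A' ≥ A, MI.Ker β A' (MI.kk (Ω j)) := fun j =>
    MI.kk_ker (Ω j) hn hβ0 hβ1 hC₀ (hΩhom j) (hΩlip j) (hΩvan j)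
  choose A0 hA0 using hk
  obtain ⟨A, hA1, hA⟩ : ∃ A : ℝ, 1 ≤ A ∧ ∀ j, MI.Ker β A (MI.kk (Ω j)) := by
    refine ⟨1 + ∑ j, |A0 j|, ?_, fun j => hA0 j _ ?_⟩
    · have : 0 ≤ ∑ j, |A0 j| := Finset.sum_nonneg fun _ _ => abs_nonneg _
      linarith
    · have : |A0 j| ≤ ∑ j, |A0 j| :=
        Finset.single_le_sum (f := fun j => |A0 j|) (fun _ _ => abs_nonneg _) (Finset.mem_univ j)
      have := le_abs_self (A0 j)
      show A0 j ≤ _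
      linarith
  set a := ∑ j, α j with ha
  have hα1' : ∀ j, α j < 1 := fun j => (hα1 j).trans_le (by
    rw [div_le_one (by positivity)]; exact_mod_cast hm)
  have haβ : a < β := by linarith
  set κ2 : ℝ := 1 / (2 * a) + (m : ℝ) ^ 2 / (2 * β - 2 * a) with hκ2
  have hκ2pos : 0 < κ2 := by
    have : 0 < 2 * β - 2 * a := by linarith
    positivity
  have hApos : 0 < A := by linarith
  refine ⟨2 * A ^ m * Real.sqrt κ2, by positivity, ?_⟩
  intro f _ hfl
  set L : Fin m → ℝ := fun j => (lipNorm n (α j) (f j)).toReal with hL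
  have hL0 : ∀ j, 0 ≤ L j := fun j => ENNReal.toReal_nonneg
  have hfL : ∀ j x y, |f j x - f j y| ≤ L j * ‖x - y‖ ^ (α j) :=
    fun j x y => MI.lip_bound (hα0 j) (hfl j) x y
  set P : ℝ := ∏ j, L j with hP
  have hP0 : 0 ≤ P := Finset.prod_nonneg fun j _ => hL0 j
  set G : Fin m → ℝ → EuclideanSpace ℝ (Fin n) → ℝ :=
    fun j t x => ∫ u, MI.kk (Ω j) u * f j (x - t • u) with hG
  have hF : ∀ x, ∀ t ∈ Set.Ioi (0:ℝ), sFt n m Ω f t x = ∏ j, G j t x := by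
    intro x t ht
    have ht : 0 < t := ht
    unfold sFt
    simp_rw [fun j => MI.kk_scale (Ω j) hn (hΩhom j) (f j) x ht]
    rw [Finset.prod_mul_distrib, Finset.prod_const, Finset.card_univ, Fintype.card_fin,
      Real.rpow_neg ht.le, Real.rpow_natCast, ← mul_assoc, inv_mul_cancel₀ (by positivity), one_mul]
  have hS : ∀ x, smarc n m Ω f x
      = (∫⁻ t in Set.Ioi (0 : ℝ), ENNReal.ofReal ((∏ j, G j t x) ^ 2 / t)) ^ (1 / 2 : ℝ) := by
    intro x
    unfold smarc
    congr 1
    refine setLIntegral_congr_fun measurableSet_Ioi fun t ht => ?_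
    simp only [hF x t ht]
  have hGm : ∀ x, Measurable (fun t => ∏ j, G j t x) := fun x =>
    Finset.measurable_fun_prod _ fun j _ =>
      MI.G_meas (hA j) (MI.holder_cont (hα0 j) (hfL j)) x
  have hcprod : ∀ t : ℝ, 0 < t → ∏ j, (A * L j * t ^ (α j)) = A ^ m * P * t ^ a := by
    intro t ht
    rw [Finset.prod_mul_distrib, Finset.prod_mul_distrib, Finset.prod_const, Finset.card_univ,
      Fintype.card_fin, ha, Real.rpow_sum_of_pos ht]
  have hGb : ∀ x j t, 0 < t → |G j t x| ≤ A * L j * t ^ (α j) := fun x j t ht =>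
    MI.G_bound (hA j) (hL0 j) (hα0 j) (hfL j) x ht
  have hPb : ∀ x t, 0 < t → |∏ j, G j t x| ≤ A ^ m * P * t ^ a := by
    intro x t ht
    rw [← hcprod t ht, Finset.abs_prod]
    exact Finset.prod_le_prod (fun _ _ => abs_nonneg _) (fun j _ => hGb x j t ht)
  have key : ∀ x y, x ≠ y → smarc n m Ω f x ≤ smarc n m Ω f y +
      ENNReal.ofReal (2 * A ^ m * Real.sqrt κ2 * P * ‖x - y‖ ^ a) := by
    intro x y hxy
    have hr : 0 < ‖x - y‖ := norm_pos_iff.mpr (sub_ne_zero.mpr hxy)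
    rw [hS x, hS y]
    have hDDm : Measurable (MI.DD a β m ‖x - y‖) := by
      unfold MI.DD
      refine Measurable.ite measurableSet_Iic ?_ ?_ <;> fun_prop
    have hDD0 : ∀ t > 0, 0 ≤ MI.DD a β m ‖x - y‖ t := by
      intro t ht
      unfold MI.DD
      split_ifs <;> positivity
    refine MI.minkowski (D := fun t => (2 * A ^ m * P) * MI.DD a β m ‖x - y‖ t) (hGm y)
      (hDDm.const_mul _) (by positivity) ?_ ?_ ?_
    · intro t ht
      have htri : |∏ j, G j t x| ≤ |∏ j, G j t y| + |∏ j, G j t x - ∏ j, G j t y| := by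
        have := abs_add_le (∏ j, G j t y) (∏ j, G j t x - ∏ j, G j t y)
        simpa using this
      refine htri.trans ?_
      gcongr
      unfold MI.DD
      split_ifs with h
      · calc |∏ j, G j t x - ∏ j, G j t y| ≤ |∏ j, G j t x| + |∏ j, G j t y| := abs_sub _ _
          _ ≤ A ^ m * P * t ^ a + A ^ m * P * t ^ a := add_le_add (hPb x t ht) (hPb y t ht)
          _ = _ := by ring
      · have := MI.prod_diff Finset.univ (fun j => G j t x) (fun j => G j t y)
          (fun j => A * L j * t ^ (α j)) (2 * (‖x - y‖ / t) ^ β) (fun j => hGb x j t ht)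
          (fun j => hGb y j t ht) (fun j => MI.G_diff (hA j) (hL0 j) (hα0 j) (hα1' j) (hfL j)
            y x ht (not_le.mp h).le)
        rw [hcprod t ht, Finset.card_univ, Fintype.card_fin] at this
        refine this.trans (le_of_eq ?_)
        ring
    · intro t ht
      have := hDD0 t ht
      positivity
    · have h1 : ∀ t, ENNReal.ofReal (((2 * A ^ m * P) * MI.DD a β m ‖x - y‖ t) ^ 2 / t)
          = ENNReal.ofReal ((2 * A ^ m * P) ^ 2)
            * ENNReal.ofReal ((MI.DD a β m ‖x - y‖ t) ^ 2 / t) := by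
        intro t
        rw [← ENNReal.ofReal_mul (by positivity)]
        congr 1; ring
      simp_rw [h1]
      rw [lintegral_const_mul' _ _ ENNReal.ofReal_ne_top]
      calc _ ≤ ENNReal.ofReal ((2 * A ^ m * P) ^ 2) * ENNReal.ofReal (κ2 * (‖x - y‖ ^ a) ^ 2) := by
            gcongr
            exact MI.DD_lint hαsum0 haβ (by positivity) hr
        _ = _ := by
            rw [← ENNReal.ofReal_mul (by positivity)]
            congr 1
            have := Real.sq_sqrt hκ2pos.le
            linear_combination (-(2 * A ^ m * P) ^ 2 * (‖x - y‖ ^ a) ^ 2) * this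
  by_cases hall : ∀ x, smarc n m Ω f x = ⊤
  · exact Or.inl hall
  right
  push Not at hall
  obtain ⟨x0, hx0⟩ := hall
  have hfin : ∀ x, smarc n m Ω f x < ⊤ := by
    intro x
    by_cases hx : x = x0
    · rw [hx]; exact lt_top_iff_ne_top.mpr hx0
    · exact (key x x0 hx).trans_lt
        (ENNReal.add_lt_top.mpr ⟨lt_top_iff_ne_top.mpr hx0, ENNReal.ofReal_lt_top⟩)
  refine ⟨Filter.Eventually.of_forall hfin, ?_⟩
  have hprod : ∏ j, lipNorm n (α j) (f j) = ENNReal.ofReal P := by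
    rw [hP, ENNReal.ofReal_prod_of_nonneg (fun j _ => hL0 j)]
    exact Finset.prod_congr rfl fun j _ => (ENNReal.ofReal_toReal (hfl j).ne).symm
  rw [hprod, ← ENNReal.ofReal_mul (by positivity)]
  have keyR : ∀ x y, x ≠ y → (smarc n m Ω f x).toReal ≤ (smarc n m Ω f y).toReal +
      2 * A ^ m * Real.sqrt κ2 * P * ‖x - y‖ ^ a := by
    intro x y hxy
    have h1 := ENNReal.toReal_mono
      (ENNReal.add_lt_top.mpr ⟨hfin y, ENNReal.ofReal_lt_top⟩).ne (key x y hxy)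
    rwa [ENNReal.toReal_add (hfin y).ne ENNReal.ofReal_ne_top,
      ENNReal.toReal_ofReal (by positivity)] at h1
  unfold lipNorm
  refine iSup_le fun x => iSup_le fun y => iSup_le fun hxy => ?_
  apply ENNReal.ofReal_le_ofReal
  have hr : 0 < ‖x - y‖ ^ a := Real.rpow_pos_of_pos (norm_pos_iff.mpr (sub_ne_zero.mpr hxy)) _
  rw [div_le_iff₀ hr, abs_sub_le_iff]
  have h1 := keyR x y hxy
  have h2 := keyR y x hxy.symm
  rw [norm_sub_rev] at h2
  constructor <;> linarith
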